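/- Let K be a compact subset of ℝ^d equipped with an absolutely α-friendly measure μ, and let ψ(r) = r^{−(d+1)/d}(log r)^{−β} for r ≥ 2, where β > 1/α. Then μ(K ∩ W(ψ)) = 0. -/

import Mathlib

open MeasureTheory Metric Set

noncomputable section

/-- The set of psi-well approximable points in R^d. -/
def WellApprox (d : ℕ) (ψ : ℝ → ℝ) : Set (EuclideanSpace ℝ (Fin d)) :=
  {x | {pq : (Fin d → ℤ) × ℕ | 0 < pq.2 ∧
      ∀ i, |x i - (pq.1 i : ℝ) / (pq.2 : ℝ)| ≤ ψ (pq.2 : ℝ)}.Infinite}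

/-- μ is doubling on K with constant D for radii below r₀. -/
def IsDoubling (d : ℕ) (K : Set (EuclideanSpace ℝ (Fin d)))
    (μ : Measure (EuclideanSpace ℝ (Fin d))) (D r₀ : ℝ) : Prop :=
  ∀ x ∈ K, ∀ r : ℝ, 0 < r → r < r₀ →
    μ (ball x (2 * r)) ≤ ENNReal.ofReal D * μ (ball x r)

/-- μ is absolutely α-decaying on K with constants C, α, r₀. -/
def IsAbsolutelyDecaying (d : ℕ) (K : Set (EuclideanSpace ℝ (Fin d)))
    (μ : Measure (EuclideanSpace ℝ (Fin d))) (C α r₀ : ℝ) : Prop :=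
  ∀ L : AffineSubspace ℝ (EuclideanSpace ℝ (Fin d)),
    (L : Set (EuclideanSpace ℝ (Fin d))).Nonempty →
    Module.finrank ℝ L.direction = d - 1 →
    ∀ ε : ℝ, 0 < ε → ∀ x ∈ K, ∀ r : ℝ, 0 < r → r < r₀ →
      μ (ball x r ∩ Metric.thickening ε (L : Set (EuclideanSpace ℝ (Fin d))))
        ≤ ENNReal.ofReal (C * (ε / r) ^ α) * μ (ball x r)

/-- **Simplex lemma, determinant form**: rational points of denominator at most `N` lying in a
small cube span a simplex of volume zero. -/
lemma det_sub_eq_zero_of_rational {d : ℕ} {N : ℕ} {ρ : ℝ}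
    (hN : (N : ℝ) ^ (d + 1) * (d.factorial * ρ ^ d) < 1)
    (p₀ : Fin d → ℤ) (q₀ : ℕ) (hq₀ : 0 < q₀) (hq₀N : q₀ ≤ N)
    (p : Fin d → Fin d → ℤ) (q : Fin d → ℕ) (hq : ∀ j, 0 < q j) (hqN : ∀ j, q j ≤ N)
    (hρ : ∀ j i, |(p j i : ℝ) / q j - (p₀ i : ℝ) / q₀| ≤ ρ) :
    (Matrix.of fun j i => (p j i : ℝ) / q j - (p₀ i : ℝ) / q₀).det = 0 := by
  set A : Matrix (Fin d) (Fin d) ℝ :=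
    Matrix.of fun j i => (p j i : ℝ) / q j - (p₀ i : ℝ) / q₀ with hA
  let H : Matrix (Unit ⊕ Fin d) (Unit ⊕ Fin d) ℝ :=
    Matrix.fromBlocks 1 (Matrix.of fun _ i => (p₀ i : ℝ) / q₀) (Matrix.of fun _ _ => 1)
      (Matrix.of fun j i => (p j i : ℝ) / q j)
  have hH : H.det = A.det := by
    rw [Matrix.det_fromBlocks_one₁₁]
    congr 1
    ext j i
    simp [hA, Matrix.mul_apply]
  let v : Unit ⊕ Fin d → ℝ := Sum.elim (fun _ => (q₀ : ℝ)) fun j => (q j : ℝ)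
  let M : Matrix (Unit ⊕ Fin d) (Unit ⊕ Fin d) ℤ :=
    Matrix.fromBlocks (Matrix.of fun _ _ => (q₀ : ℤ)) (Matrix.of fun _ i => p₀ i)
      (Matrix.of fun j _ => (q j : ℤ)) (Matrix.of fun j i => p j i)
  have hM : M.map (fun x : ℤ => (x : ℝ)) = Matrix.diagonal v * H := by
    ext (a | a) (b | b)
    · simp [M, H, v, Matrix.diagonal_mul]
    · have : (q₀ : ℝ) ≠ 0 := by positivity
      simp only [Matrix.map_apply, Matrix.fromBlocks_apply₁₂, Matrix.of_apply,
        Matrix.diagonal_mul, M, H, v, Sum.elim_inl]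
      field_simp
    · simp [M, H, v, Matrix.diagonal_mul]
    · have : (q a : ℝ) ≠ 0 := by have := hq a; positivity
      simp only [Matrix.map_apply, Matrix.fromBlocks_apply₂₂, Matrix.of_apply,
        Matrix.diagonal_mul, M, H, v, Sum.elim_inr]
      field_simp
  have hdet : ((M.det : ℤ) : ℝ) = (q₀ * ∏ j, (q j : ℝ)) * A.det := by
    rw [Int.cast_det, hM, Matrix.det_mul, Matrix.det_diagonal, hH]
    simp [v]
  have hprod : (q₀ * ∏ j, (q j : ℝ)) ≤ (N : ℝ) ^ (d + 1) := by
    have h1 : ∏ j, (q j : ℝ) ≤ ∏ _j : Fin d, (N : ℝ) :=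
      Finset.prod_le_prod (fun _ _ => by positivity) fun j _ => by exact_mod_cast hqN j
    rw [Finset.prod_const, Finset.card_univ, Fintype.card_fin] at h1
    rw [pow_succ']
    have h0 : (q₀ : ℝ) ≤ N := by exact_mod_cast hq₀N
    gcongr
  have hAle : |A.det| ≤ d.factorial * ρ ^ d := by
    have := Matrix.det_le (A := A) (abv := AbsoluteValue.abs) (x := ρ) fun j i => hρ j i
    simpa using this
  have hlt : |((M.det : ℤ) : ℝ)| < 1 := by
    rw [hdet, abs_mul, abs_of_nonneg (by positivity)]
    exact lt_of_le_of_lt (mul_le_mul hprod hAle (abs_nonneg _) (by positivity)) hN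
  have hM0 : M.det = 0 := by
    rw [← Int.abs_lt_one_iff]
    exact_mod_cast hlt
  rw [hM0, Int.cast_zero, eq_comm, mul_eq_zero] at hdet
  refine hdet.resolve_left ?_
  have : ∏ j, (q j : ℝ) ≠ 0 := Finset.prod_ne_zero_iff.2 fun j _ => by
    have := hq j; positivity
  have : (q₀ : ℝ) ≠ 0 := by positivity
  positivity

/-- A proper subspace translated to any point is contained in an affine hyperplane. -/
lemma exists_hyperplane_of_lt_top {d : ℕ} {V : Submodule ℝ (EuclideanSpace ℝ (Fin d))}
    (hV : V < ⊤) (p : EuclideanSpace ℝ (Fin d)) :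
    ∃ L : AffineSubspace ℝ (EuclideanSpace ℝ (Fin d)),
      (L : Set (EuclideanSpace ℝ (Fin d))).Nonempty ∧
      Module.finrank ℝ L.direction = d - 1 ∧ ∀ y, y - p ∈ V → y ∈ L := by
  obtain ⟨f, hf, hVf⟩ := Submodule.exists_le_ker_of_lt_top V hV
  refine ⟨AffineSubspace.mk' p f.ker, ⟨p, AffineSubspace.self_mem_mk' _ _⟩, ?_, fun y hy => ?_⟩
  · have := Module.Dual.finrank_ker_add_one_of_ne_zero hf
    rw [finrank_euclideanSpace_fin] at this
    rw [AffineSubspace.direction_mk']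
    omega
  · rw [AffineSubspace.mem_mk', vsub_eq_sub]
    exact hVf hy

/-- **Simplex lemma**: rational points of denominator at most `N` lying in a small ball are
contained in an affine hyperplane. -/
lemma exists_hyperplane_of_rational {d : ℕ} (hd : 0 < d) {N : ℕ} {ρ : ℝ}
    (hN : (N : ℝ) ^ (d + 1) * (d.factorial * (2 * ρ) ^ d) < 1)
    (z : EuclideanSpace ℝ (Fin d)) :
    ∃ L : AffineSubspace ℝ (EuclideanSpace ℝ (Fin d)),
      (L : Set (EuclideanSpace ℝ (Fin d))).Nonempty ∧
      Module.finrank ℝ L.direction = d - 1 ∧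
      ∀ y ∈ ball z ρ, ∀ (p : Fin d → ℤ) (q : ℕ), 0 < q → q ≤ N →
        (∀ i, y i = (p i : ℝ) / q) → y ∈ L := by
  let S : Set (EuclideanSpace ℝ (Fin d)) := {y | y ∈ ball z ρ ∧ ∃ (p : Fin d → ℤ) (q : ℕ),
    0 < q ∧ q ≤ N ∧ ∀ i, y i = (p i : ℝ) / q}
  suffices h : ∃ L : AffineSubspace ℝ (EuclideanSpace ℝ (Fin d)),
      (L : Set (EuclideanSpace ℝ (Fin d))).Nonempty ∧
      Module.finrank ℝ L.direction = d - 1 ∧ ∀ y ∈ S, y ∈ L by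
    obtain ⟨L, h1, h2, h3⟩ := h
    exact ⟨L, h1, h2, fun y hy p q hq hqN h => h3 y ⟨hy, p, q, hq, hqN, h⟩⟩
  have : Nonempty (Fin d) := ⟨⟨0, hd⟩⟩
  rcases S.eq_empty_or_nonempty with hS | ⟨y₀, hy₀⟩
  · obtain ⟨L, h1, h2, -⟩ := exists_hyperplane_of_lt_top (d := d) bot_lt_top 0
    exact ⟨L, h1, h2, by simp [hS]⟩
  let V := Submodule.span ℝ ((fun y => y - y₀) '' S)
  have hV : V < ⊤ := by
    refine lt_top_iff_ne_top.2 fun htop => ?_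
    obtain ⟨f, hfS, -, hf⟩ := Submodule.exists_fun_fin_finrank_span_eq ℝ ((fun y => y - y₀) '' S)
    have hfr : Module.finrank ℝ (Submodule.span ℝ ((fun y => y - y₀) '' S)) = d := by
      change Module.finrank ℝ V = d
      rw [htop, finrank_top, finrank_euclideanSpace_fin]
    let g : Fin d → EuclideanSpace ℝ (Fin d) := f ∘ finCongr hfr.symm
    have hg : LinearIndependent ℝ g := hf.comp _ (finCongr hfr.symm).injective
    have hgS : ∀ j, ∃ y ∈ S, y - y₀ = g j := fun j => hfS _
    choose y hyS hyg using hgS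
    obtain ⟨hy₀z, p₀, q₀, hq₀, hq₀N, hpq₀⟩ := hy₀
    choose hyz p q hq hqN hpq using hyS
    have hgji : ∀ j i, g j i = (p j i : ℝ) / q j - (p₀ i : ℝ) / q₀ := fun j i => by
      rw [← hyg, ← hpq, ← hpq₀, PiLp.sub_apply]
    have hdet := det_sub_eq_zero_of_rational hN p₀ q₀ hq₀ hq₀N p q hq hqN fun j i => by
      rw [← hgji, ← hyg]
      refine (PiLp.norm_apply_le (y j - y₀) i).trans ?_
      rw [← dist_eq_norm]
      have := dist_triangle_right (y j) y₀ z
      have := mem_ball.1 hy₀z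
      have := mem_ball.1 (hyz j)
      linarith
    have hli := hg.map' (WithLp.linearEquiv 2 ℝ (Fin d → ℝ)).toLinearMap (LinearEquiv.ker _)
    have hrow : (Matrix.of fun j i => (p j i : ℝ) / q j - (p₀ i : ℝ) / q₀).row =
        (WithLp.linearEquiv 2 ℝ (Fin d → ℝ)).toLinearMap ∘ g := by
      ext j i
      exact (hgji j i).symm
    rw [← hrow, Matrix.linearIndependent_rows_iff_isUnit, Matrix.isUnit_iff_isUnit_det,
      hdet] at hli
    exact not_isUnit_zero hli
  obtain ⟨L, h1, h2, h3⟩ := exists_hyperplane_of_lt_top hV y₀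
  exact ⟨L, h1, h2, fun y hy => h3 y (Submodule.subset_span ⟨y, hy, rfl⟩)⟩

/-- A local proportion bound on all balls of radius `r` centred on `K` gives a global bound. -/
lemma measure_inter_le_of_isDoubling {d : ℕ} {K : Set (EuclideanSpace ℝ (Fin d))}
    {μ : Measure (EuclideanSpace ℝ (Fin d))} {D r₀ : ℝ} (hdbl : IsDoubling d K μ D r₀)
    {r : ℝ} (hr : 0 < r) (hrr₀ : r < r₀) (A : Set (EuclideanSpace ℝ (Fin d))) (κ : ENNReal)
    (hA : ∀ z ∈ K, μ (ball z r ∩ A) ≤ κ * μ (ball z r)) :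
    μ (K ∩ A) ≤ κ * (ENNReal.ofReal D * μ univ) := by
  obtain ⟨u, huK, hdisj, hcov⟩ := Vitali.exists_disjoint_subfamily_covering_enlargement
    (fun x : EuclideanSpace ℝ (Fin d) => ball x (r / 2)) K (fun _ => 1) 2 one_lt_two
    (fun _ _ => zero_le_one) 1 (fun _ _ => le_rfl) fun a _ => ⟨a, mem_ball_self (by positivity)⟩
  have hu : u.Countable := hdisj.countable_of_isOpen (fun _ _ => isOpen_ball)
    fun a _ => ⟨a, mem_ball_self (by positivity)⟩
  have : Countable u := hu.to_subtype
  have hsub : K ∩ A ⊆ ⋃ z : u, ball (z : EuclideanSpace ℝ (Fin d)) r ∩ A := by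
    rintro x ⟨hxK, hxA⟩
    obtain ⟨b, hb, ⟨y, hy1, hy2⟩, -⟩ := hcov x hxK
    refine mem_iUnion.2 ⟨⟨b, hb⟩, ?_, hxA⟩
    rw [mem_ball] at *
    have := dist_triangle_left x b y
    linarith
  calc μ (K ∩ A) ≤ ∑' z : u, μ (ball (z : EuclideanSpace ℝ (Fin d)) r ∩ A) :=
        (measure_mono hsub).trans (measure_iUnion_le _)
    _ ≤ ∑' z : u, κ * (ENNReal.ofReal D * μ (ball (z : EuclideanSpace ℝ (Fin d)) (r / 2))) := by
        refine ENNReal.tsum_le_tsum fun z => (hA z (huK z.2)).trans ?_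
        gcongr
        have := hdbl z (huK z.2) (r / 2) (by positivity) (by linarith)
        rwa [mul_div_cancel₀ r two_ne_zero] at this
    _ = κ * (ENNReal.ofReal D * ∑' z : u, μ (ball (z : EuclideanSpace ℝ (Fin d)) (r / 2))) := by
        rw [ENNReal.tsum_mul_left, ENNReal.tsum_mul_left]
    _ ≤ κ * (ENNReal.ofReal D * μ univ) := by
        gcongr
        refine tsum_measure_le_measure_univ (fun _ => measurableSet_ball.nullMeasurableSet) ?_
        intro a b hab
        exact (hdisj a.2 b.2 (Subtype.coe_injective.ne hab)).aedisjoint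

lemma EuclideanSpace.dist_le_card_mul {d : ℕ} {x y : EuclideanSpace ℝ (Fin d)} {c : ℝ}
    (h : ∀ i, |x i - y i| ≤ c) : dist x y ≤ d * c := by
  have h1 : dist x y ≤ ∑ i, |x i - y i| := by
    rw [EuclideanSpace.dist_eq]
    refine Real.sqrt_le_iff.2 ⟨by positivity, ?_⟩
    simp only [Real.dist_eq]
    exact Finset.sum_sq_le_sq_sum_of_nonneg fun _ _ => abs_nonneg _
  refine h1.trans ((Finset.sum_le_sum fun i _ => h i).trans ?_)
  simp

/-- The points within sup-distance `η` of a rational point with denominator in `[1, N]`. -/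
def rationalNhd (d N : ℕ) (η : ℝ) : Set (EuclideanSpace ℝ (Fin d)) :=
  {x | ∃ (p : Fin d → ℤ) (q : ℕ), 0 < q ∧ q ≤ N ∧ ∀ i, |x i - (p i : ℝ) / q| ≤ η}

lemma measure_inter_rationalNhd_le {d : ℕ} (hd : 0 < d) {K : Set (EuclideanSpace ℝ (Fin d))}
    {μ : Measure (EuclideanSpace ℝ (Fin d))} {C D α r₀ : ℝ}
    (hdbl : IsDoubling d K μ D r₀) (hdec : IsAbsolutelyDecaying d K μ C α r₀)
    {N : ℕ} {r η : ℝ} (hr : 0 < r) (hrr₀ : r < r₀) (hη : 0 < η) (hηr : d * η ≤ r)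
    (hN : (N : ℝ) ^ (d + 1) * (d.factorial * (4 * r) ^ d) < 1) :
    μ (K ∩ rationalNhd d N η) ≤
      ENNReal.ofReal (C * ((d + 1) * η / r) ^ α) * (ENNReal.ofReal D * μ univ) := by
  refine measure_inter_le_of_isDoubling hdbl hr hrr₀ _ _ fun z hz => ?_
  obtain ⟨L, hL, hLd, hLy⟩ := exists_hyperplane_of_rational hd (ρ := 2 * r)
    (by rwa [show 2 * (2 * r) = 4 * r by ring]) z
  refine le_trans (measure_mono ?_) (hdec L hL hLd ((d + 1) * η) (by positivity) z hz r hr hrr₀)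
  rintro x ⟨hxz, p, q, hq, hqN, hx⟩
  refine ⟨hxz, ?_⟩
  let y : EuclideanSpace ℝ (Fin d) := WithLp.toLp 2 fun i => (p i : ℝ) / q
  have hxy : dist x y ≤ d * η := EuclideanSpace.dist_le_card_mul hx
  refine mem_thickening_iff.2 ⟨y, hLy y ?_ p q hq hqN fun _ => rfl, by linarith⟩
  rw [mem_ball] at *
  have := dist_triangle_left y z x
  linarith

lemma finite_rational_near {d : ℕ} (x : EuclideanSpace ℝ (Fin d)) (η : ℝ) {q : ℕ} (hq : 0 < q) :
    {p : Fin d → ℤ | ∀ i, |x i - (p i : ℝ) / q| ≤ η}.Finite := by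
  refine (Set.finite_Icc (fun i => ⌈q * (x i - η)⌉) fun i => ⌊q * (x i + η)⌋).subset ?_
  intro p hp
  have hq' : (0 : ℝ) < q := by exact_mod_cast hq
  have key : ∀ i, q * (x i - η) ≤ p i ∧ (p i : ℝ) ≤ q * (x i + η) := by
    intro i
    have h := abs_le.1 (hp i)
    constructor
    · rw [mul_comm, ← le_div_iff₀ hq']
      linarith
    · rw [mul_comm, ← div_le_iff₀ hq']
      linarith
  exact ⟨fun i => Int.ceil_le.2 (key i).1, fun i => Int.le_floor.2 (key i).2⟩

/-- A well approximable point is approximated with arbitrarily large denominators. -/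
lemma exists_denom_ge_of_mem_wellApprox {d : ℕ} {ψ : ℝ → ℝ} {x : EuclideanSpace ℝ (Fin d)}
    (hx : x ∈ WellApprox d ψ) (M : ℕ) :
    ∃ (p : Fin d → ℤ) (q : ℕ), 0 < q ∧ M ≤ q ∧ ∀ i, |x i - (p i : ℝ) / q| ≤ ψ q := by
  by_contra! h
  refine hx (((Set.finite_lt_nat M).biUnion fun q _ => ?_ : (⋃ q ∈ {q | q < M},
    {pq : (Fin d → ℤ) × ℕ | 0 < q ∧ pq.2 = q ∧
      ∀ i, |x i - (pq.1 i : ℝ) / q| ≤ ψ q}).Finite).subset ?_)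
  · rcases Nat.eq_zero_or_pos q with rfl | hq
    · simp
    · refine ((finite_rational_near x (ψ q) hq).prod (finite_singleton q)).subset ?_
      rintro ⟨p, q'⟩ ⟨-, hq', hp⟩
      exact ⟨hp, hq'⟩
  · rintro ⟨p, q⟩ ⟨hq, hp⟩
    refine mem_biUnion (x := q) (?_ : q < M) ⟨hq, rfl, hp⟩
    by_contra hM
    obtain ⟨i, hi⟩ := h p q hq (not_lt.1 hM)
    exact absurd (hp i) (not_le.2 hi)

lemma simplex_volume_lt_one {d : ℕ} (hd : 0 < d) {N : ℝ} (hN : 0 < N) :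
    N ^ (d + 1) * (d.factorial * (4 * (N ^ (-(((d : ℝ) + 1) / d)) / (8 * d))) ^ d) < 1 := by
  have hd' : (0 : ℝ) < d := by exact_mod_cast hd
  have h1 : (N ^ (-(((d : ℝ) + 1) / d))) ^ d = (N ^ (d + 1))⁻¹ := by
    rw [← Real.rpow_natCast, ← Real.rpow_mul hN.le, ← Real.rpow_natCast, ← Real.rpow_neg hN.le]
    congr 1
    push_cast
    field_simp
  have h2 : (4 * (N ^ (-(((d : ℝ) + 1) / d)) / (8 * d))) ^ d =
      (N ^ (d + 1))⁻¹ * ((1 / 2) ^ d / (d : ℝ) ^ d) := by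
    rw [← h1, ← div_pow, ← mul_pow]
    congr 1
    field_simp
    norm_num
  have h3 : (d.factorial : ℝ) ≤ (d : ℝ) ^ d := by exact_mod_cast Nat.factorial_le_pow d
  have h4 : ((1 : ℝ) / 2) ^ d < 1 := pow_lt_one₀ (by norm_num) (by norm_num) hd.ne'
  calc N ^ (d + 1) * (d.factorial * (4 * (N ^ (-(((d : ℝ) + 1) / d)) / (8 * d))) ^ d)
      = d.factorial / (d : ℝ) ^ d * (1 / 2) ^ d := by
        rw [h2]
        field_simp
    _ ≤ 1 * (1 / 2) ^ d := by
        gcongr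
        exact (div_le_one (by positivity)).2 h3
    _ < 1 := by rwa [one_mul]

lemma rpow_mul_log_rpow_le {s β : ℝ} (hs : 0 ≤ s) (hβ : 0 ≤ β) {n q : ℕ} (hn : 0 < n)
    (hq : 2 ^ n ≤ q) :
    (q : ℝ) ^ (-s) * Real.log q ^ (-β) ≤ ((2 : ℝ) ^ n) ^ (-s) * (n * Real.log 2) ^ (-β) := by
  have hq' : (2 : ℝ) ^ n ≤ q := by exact_mod_cast hq
  have hlog : n * Real.log 2 ≤ Real.log q := by
    rw [← Real.log_pow]
    exact Real.log_le_log (by positivity) hq'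
  have hpos : 0 < n * Real.log 2 := by
    have := Real.log_pos one_lt_two
    positivity
  exact mul_le_mul (Real.rpow_le_rpow_of_nonpos (by positivity) hq' (by linarith))
    (Real.rpow_le_rpow_of_nonpos hpos hlog (by linarith))
    (Real.rpow_nonneg (hpos.le.trans hlog) _) (by positivity)

/-- For ψ(r) = r^{-(d+1)/d} (log r)^{-β} with β > 1/α and an absolutely
α-friendly measure μ on a compact K, μ(K ∩ W(ψ)) = 0. -/
theorem stmt_18 (d : ℕ) (hd : 0 < d) (K : Set (EuclideanSpace ℝ (Fin d)))
    (hK : IsCompact K) (μ : Measure (EuclideanSpace ℝ (Fin d))) [IsFiniteMeasure μ]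
    (hsupp : μ Kᶜ = 0)
    (C D α r₀ : ℝ) (hC : 0 < C) (hD : 0 < D) (hα : 0 < α) (hr₀ : 0 < r₀)
    (hdbl : IsDoubling d K μ D r₀) (hdec : IsAbsolutelyDecaying d K μ C α r₀)
    (β : ℝ) (hβ : 1 / α < β) :
    μ (K ∩ WellApprox d
      (fun r => r ^ (-(((d : ℝ) + 1) / d)) * Real.log r ^ (-β))) = 0 := by
  have hd' : (0 : ℝ) < d := by exact_mod_cast hd
  have hβ0 : 0 < β := lt_trans (by positivity) hβ
  have hαβ : 1 < β * α := (div_lt_iff₀ hα).1 hβ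
  have hlog : 0 < Real.log 2 := Real.log_pos one_lt_two
  set s : ℝ := ((d : ℝ) + 1) / d
  have hs0 : 0 < s := by positivity
  let η : ℕ → ℝ := fun n => ((2 : ℝ) ^ n) ^ (-s) * (n * Real.log 2) ^ (-β)
  let r : ℕ → ℝ := fun n => ((2 : ℝ) ^ (n + 1)) ^ (-s) / (8 * d)
  let c : ℝ := (d + 1) * (8 * d) * 2 ^ s * Real.log 2 ^ (-β)
  have hc : 0 < c := by positivity
  have hr : ∀ n, 0 < r n := fun n => by positivity
  have hratio : ∀ n, (d + 1) * η n / r n = c * (n : ℝ) ^ (-β) := by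
    intro n
    have h1 : ((2 : ℝ) ^ (n + 1)) ^ (-s) = ((2 : ℝ) ^ n) ^ (-s) * (2 ^ s)⁻¹ := by
      rw [pow_succ, Real.mul_rpow (by positivity) (by positivity), Real.rpow_neg two_pos.le]
    have h2 : ((2 : ℝ) ^ n) ^ (-s) ≠ 0 := by positivity
    have h3 : (2 : ℝ) ^ s ≠ 0 := by positivity
    simp only [η, r, c]
    rw [h1, Real.mul_rpow (by positivity) hlog.le]
    generalize ((2 : ℝ) ^ n) ^ (-s) = a at *
    generalize (2 : ℝ) ^ s = b at *
    field_simp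
  have hr_lim : Filter.Tendsto r Filter.atTop (nhds 0) := by
    have h := (tendsto_rpow_neg_atTop hs0).comp ((tendsto_pow_atTop_atTop_of_one_lt
      (one_lt_two (α := ℝ))).comp (Filter.tendsto_add_atTop_nat 1))
    simpa using h.div_const (8 * (d : ℝ))
  have hc_lim : Filter.Tendsto (fun n : ℕ => c * (n : ℝ) ^ (-β)) Filter.atTop (nhds 0) := by
    simpa using ((tendsto_rpow_neg_atTop hβ0).comp tendsto_natCast_atTop_atTop).const_mul c
  obtain ⟨n₀, hn₀⟩ := Filter.eventually_atTop.1
    ((hr_lim.eventually (gt_mem_nhds hr₀)).and ((hc_lim.eventually (gt_mem_nhds one_pos)).and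
      (Filter.eventually_gt_atTop 0)))
  let p : ℕ → EuclideanSpace ℝ (Fin d) → Prop := fun n x =>
    n₀ ≤ n ∧ x ∈ K ∩ rationalNhd d (2 ^ (n + 1)) (η n)
  have hp : ∀ n, μ {x | p n x} ≤
      ENNReal.ofReal (C * (c * (n : ℝ) ^ (-β)) ^ α) * (ENNReal.ofReal D * μ univ) := by
    intro n
    by_cases hn : n₀ ≤ n
    · obtain ⟨hrn, hcn, hn0⟩ := hn₀ n hn
      have hη : 0 < η n := by positivity
      rw [← hratio] at hcn ⊢
      refine (measure_mono fun x hx => hx.2).trans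
        (measure_inter_rationalNhd_le hd hdbl hdec (hr n) hrn hη ?_ ?_)
      · have := (div_lt_one (hr n)).1 hcn
        linarith
      · push_cast
        exact simplex_volume_lt_one hd (by positivity)
    · simp [p, hn]
  have hsum : ∑' n, μ {x | p n x} ≠ ⊤ := by
    refine ne_top_of_le_ne_top ?_ (ENNReal.tsum_le_tsum hp)
    rw [ENNReal.tsum_mul_right]
    refine ENNReal.mul_ne_top (Summable.tsum_ofReal_ne_top ?_)
      (ENNReal.mul_ne_top ENNReal.ofReal_ne_top (measure_ne_top _ _))
    refine Summable.mul_left C ?_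
    have h : ∀ n : ℕ, (c * (n : ℝ) ^ (-β)) ^ α = c ^ α * (n : ℝ) ^ (-(β * α)) := fun n => by
      rw [Real.mul_rpow hc.le (by positivity), ← Real.rpow_mul (by positivity), neg_mul]
    simp only [h]
    exact (Real.summable_nat_rpow.2 (by linarith)).mul_left _
  refine measure_mono_null ?_ (measure_setOfPred_frequently_eq_zero hsum)
  rintro x ⟨hxK, hx⟩
  refine Filter.frequently_atTop.2 fun M => ?_
  obtain ⟨a, q, hq, hMq, ha⟩ := exists_denom_ge_of_mem_wellApprox hx (2 ^ max M n₀)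
  have hn : max M n₀ ≤ Nat.log 2 q := Nat.le_log_of_pow_le one_lt_two hMq
  have hn₀' : n₀ ≤ Nat.log 2 q := (le_max_right _ _).trans hn
  refine ⟨Nat.log 2 q, (le_max_left _ _).trans hn, hn₀', hxK, a, q, hq,
    (Nat.lt_pow_succ_log_self one_lt_two q).le, fun i => (ha i).trans ?_⟩
  exact rpow_mul_log_rpow_le hs0.le hβ0.le (hn₀ _ hn₀').2.2 (Nat.pow_log_le_self 2 hq.ne')
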